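/- Let p ≥ 1 and let n_1, …, n_p, r_1, …, r_p be non-negative integers such that r_i ≥ r_{i+1} + n_{i+1} + 1 for every i ∈ {1, …, p−1}. Let P(k_1, …, k_p) be a polynomial with rational coefficients such that deg_{k_i} P ≤ 3n_i + 1 for every i ∈ {1, …, p}. Then the series Σ_{k_1 ≥ k_2 ≥ … ≥ k_p ≥ 1} P(k_1, …, k_p) / ((k_1+r_1)_{n_1+1}^3 (k_2+r_2)_{n_2+1}^3 ⋯ (k_p+r_p)_{n_p+1}^3) converges and is a ℚ-linear combination of multiple zeta values ζ(s_1, …, s_q) with q ∈ {0, …, p} and s_i ∈ {2, 3} for every i ∈ {1, …, q}. -/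

import Mathlib

/-- The multiple zeta value `ζ(s₁, …, s_q)`, defined as a sum over strictly
decreasing tuples `k₁ > k₂ > … > k_q ≥ 1`.  For the empty list it equals `1`. -/
noncomputable def mzv (s : List ℕ) : ℝ :=
  ∑' k : {k : Fin s.length → ℕ // StrictAnti k ∧ ∀ i, 1 ≤ k i},
    ∏ i : Fin s.length, ((k.1 i : ℝ) ^ s.get i)⁻¹

open Polynomial Filter Topology

/-- `f` agrees at positive integers with `P / ∏_{a ≤ c < b} (k + c)³` for a rational polynomial `P`
of degree at most `3 (b - a) - d`. -/
def IsFrac (d a b : ℕ) (f : ℕ → ℝ) : Prop :=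
  ∃ P : ℚ[X], P.natDegree + d ≤ 3 * (b - a) ∧
    ∀ k : ℕ, 0 < k → f k = aeval (k : ℝ) P / ∏ c ∈ Finset.Ico a b, ((k : ℝ) + c) ^ 3

lemma prod_add_cube_pos (a b : ℕ) {k : ℕ} (hk : 0 < k) :
    0 < ∏ c ∈ Finset.Ico a b, ((k : ℝ) + c) ^ 3 :=
  Finset.prod_pos fun c _ => by positivity

lemma natDegree_prod_X_add_C_cube {R : Type*} [CommRing R] [Nontrivial R] (a b : ℕ) :
    (∏ c ∈ Finset.Ico a b, (X + C (c : R)) ^ 3).natDegree = 3 * (b - a) := by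
  rw [natDegree_prod_of_monic _ _ fun c _ => (monic_X_add_C _).pow 3]
  simp [(monic_X_add_C _).natDegree_pow, -map_natCast, mul_comm]

namespace IsFrac

variable {d d' a b c : ℕ} {f g : ℕ → ℝ}

lemma mul (hf : IsFrac d a b f) (hg : IsFrac d' b c g) (hab : a ≤ b) (hbc : b ≤ c) :
    IsFrac (d + d') a c (fun k => f k * g k) := by
  obtain ⟨P, hP, hf⟩ := hf
  obtain ⟨Q, hQ, hg⟩ := hg
  refine ⟨P * Q, ?_, fun k hk => ?_⟩
  · have := natDegree_mul_le (p := P) (q := Q)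
    omega
  · beta_reduce
    rw [hf k hk, hg k hk, ← Finset.prod_Ico_consecutive _ hab hbc, map_mul, div_mul_div_comm]

lemma const (q : ℚ) (a b : ℕ) : IsFrac 0 a b (fun _ => (q : ℝ)) := by
  refine ⟨C q * ∏ c ∈ Finset.Ico a b, (X + C (c : ℚ)) ^ 3, ?_, fun k hk => ?_⟩
  · refine (natDegree_C_mul_le _ _).trans ?_
    refine (natDegree_prod_le _ _).trans ?_
    refine (Finset.sum_le_card_nsmul _ _ 3 fun c _ => ?_).trans ?_
    · compute_degree
    · simp [mul_comm]
  · rw [eq_div_iff (prod_add_cube_pos a b hk).ne']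
    simp [map_prod]

lemma one (a b : ℕ) : IsFrac 0 a b (fun _ => 1) := by
  simpa using const 1 a b

lemma mono (hf : IsFrac d a b f) {a' b' : ℕ} (ha : a' ≤ a) (hb : b ≤ b') (hab : a ≤ b) :
    IsFrac d a' b' f := by
  have h := ((one a' a).mul hf ha hab).mul (one b b') (ha.trans hab) hb
  simpa using h

lemma shift (hf : IsFrac d a b f) : IsFrac d (a + 1) (b + 1) (fun k => f (k + 1)) := by
  obtain ⟨P, hP, hf⟩ := hf
  refine ⟨P.comp (X + C 1), ?_, fun k hk => ?_⟩
  · rw [natDegree_comp, natDegree_X_add_C]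
    omega
  · beta_reduce
    rw [hf (k + 1) k.succ_pos, ← Finset.prod_Ico_add']
    congr 1
    · simp [aeval_comp]
    · exact Finset.prod_congr rfl fun c _ => by push_cast; ring

lemma add (hf : IsFrac d a b f) (hg : IsFrac d a b g) : IsFrac d a b (fun k => f k + g k) := by
  obtain ⟨P, hP, hf⟩ := hf
  obtain ⟨Q, hQ, hg⟩ := hg
  refine ⟨P + Q, ?_, fun k hk => ?_⟩
  · have := natDegree_add_le P Q
    omega
  · beta_reduce
    rw [hf k hk, hg k hk, map_add, add_div]

lemma exists_rat (hf : IsFrac d a b f) {k : ℕ} (hk : 0 < k) : ∃ q : ℚ, f k = q := by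
  obtain ⟨P, -, hf⟩ := hf
  refine ⟨P.eval (k : ℚ) / ∏ c ∈ Finset.Ico a b, ((k : ℚ) + c) ^ 3, ?_⟩
  rw [hf k hk]
  push_cast
  congr 1
  simpa using aeval_algebraMap_apply_eq_algebraMap_eval (A := ℝ) (k : ℚ) P

lemma exists_tendsto (hf : IsFrac 0 a b f) : ∃ q : ℚ, Tendsto f atTop (𝓝 (q : ℝ)) := by
  obtain ⟨P, hP, hf⟩ := hf
  set M : ℝ[X] := ∏ c ∈ Finset.Ico a b, (X + C (c : ℝ)) ^ 3 with hM
  have hmonic : M.Monic := monic_prod_of_monic _ _ fun c _ => (monic_X_add_C _).pow 3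
  have hdeg : M.natDegree = 3 * (b - a) := by
    rw [hM, natDegree_prod_X_add_C_cube]
  set P' : ℝ[X] := P.map (algebraMap ℚ ℝ) with hP'
  have hev : ∀ᶠ k : ℕ in atTop, P'.eval (k : ℝ) / M.eval (k : ℝ) = f k := by
    filter_upwards [eventually_gt_atTop 0] with k hk
    rw [hf k hk]
    simp [hP', hM, eval_prod, eval_map_algebraMap]
  have hPd : P'.natDegree = P.natDegree := natDegree_map _
  rcases (show P.natDegree ≤ 3 * (b - a) by omega).lt_or_eq with h | h
  · refine ⟨0, ?_⟩
    have := div_tendsto_atTop_zero_of_degree_lt P' M (degree_lt_degree (by omega))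
    simpa using (this.comp tendsto_natCast_atTop_atTop).congr' hev
  · refine ⟨P.leadingCoeff, ?_⟩
    by_cases hP0 : P = 0
    · refine Tendsto.congr' hev ?_
      simp [hP', hP0]
    have h1 : P'.degree = M.degree := by
      rw [degree_eq_natDegree hmonic.ne_zero, hdeg, degree_eq_natDegree, hPd, h]
      simpa [hP', Polynomial.map_eq_zero] using hP0
    have := div_tendsto_atTop_leadingCoeff_div_of_degree_eq P' M h1
    rw [hmonic.leadingCoeff, div_one, hP', leadingCoeff_map] at this
    exact (this.comp tendsto_natCast_atTop_atTop).congr' hev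

lemma exists_bound (hf : IsFrac 2 a b f) : ∃ B : ℝ, ∀ k, 0 < k → |f k| ≤ B * ((k : ℝ) ^ 2)⁻¹ := by
  have h : IsFrac 0 a b (fun k => (k : ℝ) ^ 2 * f k) := by
    obtain ⟨P, hP, hf⟩ := hf
    refine ⟨X ^ 2 * P, ?_, fun k hk => ?_⟩
    · have := natDegree_mul_le (p := X ^ 2) (q := P)
      simp only [natDegree_X_pow] at this
      omega
    · beta_reduce
      rw [hf k hk]
      simp [mul_div_assoc]
  obtain ⟨q, hq⟩ := h.exists_tendsto
  obtain ⟨B, hB⟩ := (Metric.isBounded_range_of_tendsto _ hq).exists_norm_le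
  refine ⟨B, fun k hk => ?_⟩
  have := hB _ ⟨k, rfl⟩
  rw [Real.norm_eq_abs, abs_mul, abs_of_nonneg (by positivity)] at this
  rw [← div_eq_mul_inv, le_div_iff₀ (by positivity), mul_comm]
  exact this

lemma inv_pow {s : ℕ} (hs : s = 2 ∨ s = 3) (a : ℕ) :
    IsFrac 2 a (a + 1) (fun k => (((k : ℝ) + a) ^ s)⁻¹) := by
  rcases hs with rfl | rfl
  · refine ⟨X + C (a : ℚ), by rw [natDegree_X_add_C]; omega, fun k hk => ?_⟩
    have : (k : ℝ) + a ≠ 0 := by positivity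
    simp
    field_simp
  · exact ⟨1, by simp, fun k hk => by simp⟩

end IsFrac

lemma natDegree_telescope_le (Q : ℚ[X]) (hQ : Q.natDegree ≤ 2) (e : ℚ) :
    (Q * (X + C e) ^ 3 - Q.comp (X - C 1) * (X + C e + C 1) ^ 3).natDegree ≤ 4 := by
  obtain ⟨u, v, w, rfl⟩ : ∃ u v w : ℚ,
      Q = C u + C v * (X + C e + C 1) + C w * (X + C e + C 1) ^ 2 := by
    have hT : (Q.comp (X - C (e + 1))).natDegree ≤ 2 := by
      rw [natDegree_comp, natDegree_X_sub_C]; omega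
    set T := Q.comp (X - C (e + 1)) with hTdef
    refine ⟨T.coeff 0, T.coeff 1, T.coeff 2, ?_⟩
    have h1 := T.as_sum_range_C_mul_X_pow' (n := 3) (by omega)
    have h2 : Q = T.comp (X + C e + C 1) := by
      rw [hTdef, comp_assoc]
      simp [add_assoc]
    rw [h2]
    conv_lhs => rw [h1]
    simp [Finset.sum_range_succ]
  have : (C u + C v * (X + C e + C 1) + C w * (X + C e + C 1) ^ 2) * (X + C e) ^ 3 -
      (C u + C v * (X + C e + C 1) + C w * (X + C e + C 1) ^ 2).comp (X - C 1) *
        (X + C e + C 1) ^ 3 =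
      -(C u * (3 * (X + C e) ^ 2 + 3 * (X + C e) + 1) +
        C v * ((X + C e) * (X + C e + 1) * (2 * (X + C e) + 1)) +
        C w * ((X + C e) ^ 2 * (X + C e + 1) ^ 2)) := by
    simp only [add_comp, mul_comp, C_comp, X_comp, pow_comp, map_one, one_comp]
    ring
  rw [this]
  compute_degree

/-- Partial fractions with coprime monic denominators. -/
lemma exists_eq_mul_add_mul_of_isCoprime {M N : ℚ[X]} (h : IsCoprime M N) (hN : N.Monic)
    (hN1 : N ≠ 1) (P : ℚ[X]) :
    ∃ Q P' : ℚ[X], P = Q * M + P' * N ∧ Q.natDegree < N.natDegree := by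
  obtain ⟨u, v, huv⟩ := h
  refine ⟨(P * u) %ₘ N, P * v + M * ((P * u) /ₘ N), ?_, natDegree_modByMonic_lt _ hN hN1⟩
  linear_combination (-P) * huv - M * modByMonic_add_div (P * u) N

lemma IsFrac.reduce {a m : ℕ} {f : ℕ → ℝ} (hf : IsFrac 2 a (a + m + 2) f) :
    ∃ f' G : ℕ → ℝ, IsFrac 2 a (a + m + 1) f' ∧ IsFrac 0 a (a + m + 1) G ∧
      ∀ k, 0 < k → f k = f' k + (G (k + 1) - G k) := by
  obtain ⟨P, hP, hf⟩ := hf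
  set K : ℚ[X] := ∏ c ∈ Finset.Ico a (a + m), (X + C (c : ℚ)) ^ 3 with hK
  set e : ℚ := ((a + m : ℕ) : ℚ) with he
  have hKdeg : K.natDegree = 3 * m := by
    rw [hK, natDegree_prod_X_add_C_cube, Nat.add_sub_cancel_left]
  have hL1 : (X + C e + C 1 : ℚ[X]) = X + C (((a + m + 1 : ℕ) : ℚ)) := by
    simp [he, add_assoc]
  have hmonic : ((X + C e + C 1 : ℚ[X]) ^ 3).Monic := by
    rw [hL1]; exact (monic_X_add_C _).pow 3
  have hdeg3 : ((X + C e + C 1 : ℚ[X]) ^ 3).natDegree = 3 := by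
    rw [hL1, natDegree_pow, natDegree_X_add_C]
  have hcop : IsCoprime (K * (X + C e) ^ 3) ((X + C e + C 1 : ℚ[X]) ^ 3) := by
    have : ∀ c : ℕ, c < a + m + 1 →
        IsCoprime ((X + C (c : ℚ)) ^ 3) ((X + C e + C 1 : ℚ[X]) ^ 3) := by
      intro c hc
      rw [hL1]
      refine IsCoprime.pow ?_
      have h : IsUnit (-(c : ℚ) - -((a + m + 1 : ℕ) : ℚ)) := by
        rw [isUnit_iff_ne_zero, sub_ne_zero, Ne, neg_inj]
        exact_mod_cast hc.ne
      simpa only [C_neg, sub_neg_eq_add] using isCoprime_X_sub_C_of_isUnit_sub h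
    refine IsCoprime.mul_left (IsCoprime.prod_left fun c hc => this c ?_) (this _ (by omega))
    have := (Finset.mem_Ico.1 hc).2
    omega
  obtain ⟨Q, P', hPQ, hQ⟩ := exists_eq_mul_add_mul_of_isCoprime hcop hmonic
    (fun h => by rw [h] at hdeg3; simp at hdeg3) P
  rw [hdeg3] at hQ
  have hQ' : (Q.comp (X - C 1)).natDegree ≤ 2 := by
    rw [natDegree_comp, natDegree_X_sub_C]; omega
  set P'' : ℚ[X] := P' + Q.comp (X - C 1) * K with hP''
  have hmul : (X + C e + C 1) ^ 3 * P'' =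
      P - K * (Q * (X + C e) ^ 3 - Q.comp (X - C 1) * (X + C e + C 1) ^ 3) := by
    rw [hP'']
    linear_combination -hPQ
  have hdegP'' : P''.natDegree + 2 ≤ 3 * (m + 1) := by
    by_cases h0 : P'' = 0
    · rw [h0, natDegree_zero]; omega
    have h1 := congrArg natDegree hmul
    rw [hmonic.natDegree_mul' h0, hdeg3] at h1
    have h2 := natDegree_sub_le P
      (K * (Q * (X + C e) ^ 3 - Q.comp (X - C 1) * (X + C e + C 1) ^ 3))
    have h3 := natDegree_mul_le (p := K)
      (q := Q * (X + C e) ^ 3 - Q.comp (X - C 1) * (X + C e + C 1) ^ 3)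
    have h4 := natDegree_telescope_le Q (by omega) e
    omega
  refine ⟨fun k => aeval (k : ℝ) P'' / ∏ c ∈ Finset.Ico a (a + m + 1), ((k : ℝ) + c) ^ 3,
    fun k => aeval (k : ℝ) (Q.comp (X - C 1)) / ((k : ℝ) + (a + m : ℕ)) ^ 3,
    ⟨P'', by omega, fun k _ => rfl⟩, ?_, fun k hk => ?_⟩
  · refine IsFrac.mono (a := a + m) (b := a + m + 1)
      ⟨Q.comp (X - C 1), by omega, fun k _ => by simp⟩ (by omega) le_rfl (by omega)
  · have hKpos := prod_add_cube_pos a (a + m) hk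
    have hKev : aeval (k : ℝ) K = ∏ c ∈ Finset.Ico a (a + m), ((k : ℝ) + c) ^ 3 := by
      simp [hK, map_prod]
    beta_reduce
    rw [hf k hk, Finset.prod_Ico_succ_top (by omega), Finset.prod_Ico_succ_top (by omega),
      ← hKev]
    rw [← hKev] at hKpos
    have h1 : aeval ((k + 1 : ℕ) : ℝ) (Q.comp (X - C 1)) = aeval (k : ℝ) Q := by
      simp [aeval_comp]
    have h2 := congrArg (aeval (k : ℝ)) hmul
    have hE : aeval (k : ℝ) (X + C e) = (k : ℝ) + (a + m : ℕ) := by simp [he]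
    have hE1 : aeval (k : ℝ) (X + C e + C 1) = (k : ℝ) + (a + m : ℕ) + 1 := by simp [he]
    simp only [map_mul, map_sub, map_pow, hE, hE1] at h2
    rw [h1]
    have p0 : (k : ℝ) + (a + m : ℕ) ≠ 0 := by positivity
    have p1 : (k : ℝ) + (a + m : ℕ) + 1 ≠ 0 := by positivity
    have c1 : ((k : ℝ) + (a + m + 1 : ℕ)) = (k : ℝ) + (a + m : ℕ) + 1 := by push_cast; ring
    have c2 : (((k + 1 : ℕ) : ℝ) + (a + m : ℕ)) = (k : ℝ) + (a + m : ℕ) + 1 := by push_cast; ring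
    rw [c1, c2]
    generalize (k : ℝ) + (a + m : ℕ) = y at *
    have := hKpos.ne'
    field_simp
    linear_combination -h2

lemma IsFrac.exists_telescope {a m : ℕ} {f : ℕ → ℝ} (hf : IsFrac 2 a (a + m + 1) f) :
    ∃ (α β : ℚ) (G : ℕ → ℝ), IsFrac 0 a (a + m) G ∧ ∀ k, 0 < k →
      f k = α * (((k : ℝ) + a) ^ 2)⁻¹ + β * (((k : ℝ) + a) ^ 3)⁻¹ + (G (k + 1) - G k) := by
  induction m generalizing f with
  | zero =>
    obtain ⟨P, hP, hf⟩ := hf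
    obtain ⟨u, v, rfl⟩ : ∃ u v : ℚ, P = C u * X + C v :=
      exists_eq_X_add_C_of_natDegree_le_one (by omega)
    refine ⟨u, v - u * a, fun _ => 0, by simpa using IsFrac.const 0 a (a + 0), fun k hk => ?_⟩
    have : (k : ℝ) + a ≠ 0 := by positivity
    rw [hf k hk]
    simp
    field_simp
    ring
  | succ m ih =>
    obtain ⟨f', G, hf', hG, h⟩ := hf.reduce
    obtain ⟨α, β, G', hG', h'⟩ := ih hf'
    refine ⟨α, β, fun k => G' k + G k,
      (hG'.mono le_rfl (by omega) (by omega)).add hG, fun k hk => ?_⟩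
    rw [h k hk, h' k hk]
    ring

lemma summable_pi_prod {p : ℕ} {h : Fin p → ℕ → ℝ} (h0 : ∀ i k, 0 ≤ h i k)
    (hs : ∀ i, Summable (h i)) : Summable (fun x : Fin p → ℕ => ∏ i, h i (x i)) := by
  refine summable_of_sum_le (c := ∏ i, ∑' k, h i k)
    (fun x => Finset.prod_nonneg fun i _ => h0 i _) fun u => ?_
  have hu : u ⊆ Fintype.piFinset fun i => u.image fun x => x i := fun x hx =>
    Fintype.mem_piFinset.2 fun i => Finset.mem_image_of_mem (fun x : Fin p → ℕ => x i) hx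
  refine (Finset.sum_le_sum_of_subset_of_nonneg hu
    fun x _ _ => Finset.prod_nonneg fun i _ => h0 i _).trans ?_
  rw [← Finset.prod_univ_sum]
  exact Finset.prod_le_prod (fun i _ => Finset.sum_nonneg fun k _ => h0 i k)
    fun i _ => (hs i).sum_le_tsum _ fun k _ => h0 i k

/-- The sum of `∏ᵢ R i (k i)` over `N ≥ k₀`, `kᵢ ≥ kᵢ₊₁ + e`, `kᵢ ≥ 1`. -/
noncomputable def truncSum (e : ℕ) : (p : ℕ) → (Fin p → ℕ → ℝ) → ℕ → ℝ
  | 0, _, _ => 1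
  | p + 1, R, N => ∑ k ∈ Finset.range N, R 0 (k + 1) * truncSum e p (Fin.tail R) (k + 1 - e)

lemma sum_piFinset_eq_truncSum (e p : ℕ) (R : Fin p → ℕ → ℝ) (N : ℕ) :
    ∑ x ∈ Fintype.piFinset (fun _ : Fin p => Finset.Icc 1 N) with
      ∀ i j, i < j → x j + e ≤ x i, ∏ i, R i (x i) = truncSum e p R N := by
  induction p generalizing N with
  | zero => simp [truncSum, Finset.filter_true_of_mem]
  | succ p ih =>
    simp only [truncSum, ← ih, Finset.mul_sum]
    rw [Finset.sum_sigma']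
    refine Finset.sum_bij' (fun x _ => ⟨x 0 - 1, Fin.tail x⟩)
      (fun y _ => Fin.cons (y.1 + 1) y.2) ?_ ?_ ?_ ?_ ?_
    · intro x hx
      simp only [Finset.mem_filter, Fintype.mem_piFinset, Finset.mem_Icc] at hx
      simp only [Finset.mem_sigma, Finset.mem_range, Finset.mem_filter, Fintype.mem_piFinset,
        Finset.mem_Icc, Fin.tail]
      have h0 := hx.1 0
      refine ⟨by omega, fun i => ?_, fun i j hij => hx.2 _ _ (Fin.succ_lt_succ_iff.2 hij)⟩
      have h1 := hx.1 i.succ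
      have h2 := hx.2 0 i.succ (Fin.succ_pos i)
      omega
    · rintro ⟨k, y⟩ hy
      simp only [Finset.mem_sigma, Finset.mem_range, Finset.mem_filter, Fintype.mem_piFinset,
        Finset.mem_Icc] at hy
      simp only [Finset.mem_filter, Fintype.mem_piFinset, Finset.mem_Icc, Fin.forall_fin_succ,
        Fin.cons_zero, Fin.cons_succ]
      refine ⟨⟨by omega, fun i => ?_⟩, ⟨by simp, fun j _ => ?_⟩, fun i => ⟨by simp, fun j hij => ?_⟩⟩
      · have := hy.2.1 i
        omega
      · have := hy.2.1 j
        omega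
      · exact hy.2.2 i j (Fin.succ_lt_succ_iff.1 hij)
    · intro x hx
      simp only [Finset.mem_filter, Fintype.mem_piFinset, Finset.mem_Icc] at hx
      have h0 := hx.1 0
      simp only [Nat.sub_add_cancel h0.1]
      exact Fin.cons_self_tail x
    · rintro ⟨k, y⟩ -
      simp
    · intro x hx
      simp only [Finset.mem_filter, Fintype.mem_piFinset, Finset.mem_Icc] at hx
      have h0 := hx.1 0
      simp only [Nat.sub_add_cancel h0.1]
      exact Fin.prod_univ_succ _

lemma summable_and_tendsto_truncSum {e p : ℕ} {R : Fin p → ℕ → ℝ} {B : Fin p → ℝ}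
    (hR : ∀ i k, 0 < k → |R i k| ≤ B i * ((k : ℝ) ^ 2)⁻¹) {Q : (Fin p → ℕ) → Prop}
    (hQ : ∀ x, Q x ↔ (∀ i j, i < j → x j + e ≤ x i) ∧ ∀ i, 1 ≤ x i) :
    Summable (fun x : {x // Q x} => ∏ i, R i (x.1 i)) ∧
      Tendsto (truncSum e p R) atTop (𝓝 (∑' x : {x // Q x}, ∏ i, R i (x.1 i))) := by
  classical
  have hB : ∀ i, 0 ≤ B i := fun i => by
    have := (abs_nonneg _).trans (hR i 1 one_pos)
    simpa using this
  have hsum : Summable (fun x : {x // Q x} => ∏ i, R i (x.1 i)) := by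
    refine Summable.of_abs (Summable.of_nonneg_of_le (fun _ => abs_nonneg _) (fun x => ?_)
      ((summable_pi_prod (h := fun i k => B i * ((k : ℝ) ^ 2)⁻¹)
        (fun i k => mul_nonneg (hB i) (by positivity))
        (fun i => (Real.summable_nat_pow_inv.2 one_lt_two).mul_left _)).comp_injective
          Subtype.val_injective))
    rw [Finset.abs_prod]
    exact Finset.prod_le_prod (fun _ _ => abs_nonneg _)
      fun i _ => hR i _ (((hQ _).1 x.2).2 i)
  refine ⟨hsum, ?_⟩
  set F : ℕ → Finset {x // Q x} := fun N =>
    (Fintype.piFinset (fun _ : Fin p => Finset.Icc 1 N)).subtype Q with hF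
  have hFt : Tendsto F atTop atTop := by
    refine tendsto_atTop_finset_of_monotone (fun M N hMN x hx => ?_) fun x => ?_
    · simp only [hF, Finset.mem_subtype, Fintype.mem_piFinset, Finset.mem_Icc] at hx ⊢
      exact fun i => ⟨(hx i).1, (hx i).2.trans hMN⟩
    · refine ⟨∑ i, x.1 i, ?_⟩
      simp only [hF, Finset.mem_subtype, Fintype.mem_piFinset, Finset.mem_Icc]
      exact fun i => ⟨((hQ _).1 x.2).2 i,
        Finset.single_le_sum (f := x.1) (fun _ _ => Nat.zero_le _) (Finset.mem_univ i)⟩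
  refine (hsum.hasSum.comp hFt).congr fun N => ?_
  rw [← sum_piFinset_eq_truncSum, Function.comp_apply, hF,
    Finset.sum_subtype_eq_sum_filter (f := fun x : Fin p → ℕ => ∏ i, R i (x i))]
  refine Finset.sum_congr (Finset.filter_congr fun x hx => ?_) fun _ _ => rfl
  rw [hQ]
  simp only [Fintype.mem_piFinset, Finset.mem_Icc] at hx
  exact and_iff_left fun i => (hx i).1

/-- The sum of `∏ᵢ (kᵢ + q - i)^(-sᵢ)` over `N ≥ k₁ ≥ ⋯ ≥ k_q ≥ 1`, where `q` is the length
of `s`. -/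
noncomputable def shiftSum : List ℕ → ℕ → ℝ
  | [], _ => 1
  | s :: L, N => ∑ k ∈ Finset.range N,
      ((((k + 1 : ℕ) : ℝ) + L.length) ^ s)⁻¹ * shiftSum L (k + 1)

lemma shiftSum_cons_succ (s : ℕ) (L : List ℕ) (N : ℕ) :
    shiftSum (s :: L) (N + 1) = shiftSum (s :: L) N +
      ((((N + 1 : ℕ) : ℝ) + L.length) ^ s)⁻¹ * shiftSum L (N + 1) := by
  simp [shiftSum, Finset.sum_range_succ]

lemma shiftSum_cons_zero (s : ℕ) (L : List ℕ) : shiftSum (s :: L) 0 = 0 := by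
  simp [shiftSum]

lemma truncSum_one_eq_zero {p : ℕ} (R : Fin p → ℕ → ℝ) {N : ℕ} (h : N < p) :
    truncSum 1 p R N = 0 := by
  induction p generalizing N with
  | zero => omega
  | succ p ih =>
    refine Finset.sum_eq_zero fun k hk => ?_
    rw [Finset.mem_range] at hk
    rw [ih _ (by omega), mul_zero]

lemma shiftSum_succ_eq_truncSum (s : List ℕ) (N : ℕ) :
    shiftSum s (N + 1) =
      truncSum 1 s.length (fun i k => ((k : ℝ) ^ s.get i)⁻¹) (N + s.length) := by
  induction s generalizing N with
  | nil => rfl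
  | cons s L ih =>
    change _ = ∑ k ∈ Finset.range (N + (L.length + 1)), (((k + 1 : ℕ) : ℝ) ^ s)⁻¹ *
      truncSum 1 L.length (fun i k => ((k : ℝ) ^ L.get i)⁻¹) (k + 1 - 1)
    rw [shiftSum, show N + (L.length + 1) = L.length + (N + 1) by ring,
      Finset.sum_range_add _ L.length (N + 1),
      Finset.sum_eq_zero (s := Finset.range L.length), zero_add]
    · refine Finset.sum_congr rfl fun k _ => ?_
      rw [ih, show L.length + k + 1 - 1 = k + L.length by omega]
      congr 3
      push_cast
      ring
    · intro k hk
      rw [Finset.mem_range] at hk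
      rw [truncSum_one_eq_zero _ (by omega), mul_zero]

lemma tendsto_shiftSum {s : List ℕ} (hs : ∀ a ∈ s, a = 2 ∨ a = 3) :
    Tendsto (shiftSum s) atTop (𝓝 (mzv s)) := by
  rw [← tendsto_add_atTop_iff_nat 1]
  simp only [shiftSum_succ_eq_truncSum]
  refine (tendsto_add_atTop_iff_nat s.length).2 (summable_and_tendsto_truncSum
    (B := fun _ => 1) (fun i k hk => ?_) fun x => ?_).2
  · have hk' : (1 : ℝ) ≤ k := by exact_mod_cast hk
    rw [one_mul, abs_of_nonneg (by positivity)]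
    refine inv_anti₀ (by positivity) (pow_le_pow_right₀ hk' ?_)
    rcases hs _ (s.get_mem i) with h | h <;> simp_all
  · exact Iff.rfl

/-- The functions of the truncation bound spanned by products of `shiftSum s`, with `s` of length at most `p`,
with fractions whose poles lie beyond those of `shiftSum s` and below `t`. -/
noncomputable def shiftSpan (t p : ℕ) : Submodule ℚ (ℕ → ℝ) :=
  Submodule.span ℚ {h | ∃ (s : List ℕ) (g : ℕ → ℝ), s.length ≤ p ∧ s.length ≤ t ∧
    (∀ a ∈ s, a = 2 ∨ a = 3) ∧ IsFrac 0 s.length t g ∧ h = fun N => g N * shiftSum s N}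

section shiftSpan

variable {t p : ℕ}

lemma mul_shiftSum_mem {s : List ℕ} {g : ℕ → ℝ} (hp : s.length ≤ p) (ht : s.length ≤ t)
    (hs : ∀ a ∈ s, a = 2 ∨ a = 3) (hg : IsFrac 0 s.length t g) :
    (fun N => g N * shiftSum s N) ∈ shiftSpan t p :=
  Submodule.subset_span ⟨s, g, hp, ht, hs, hg, rfl⟩

lemma shiftSum_mem {s : List ℕ} (hp : s.length ≤ p) (ht : s.length ≤ t)
    (hs : ∀ a ∈ s, a = 2 ∨ a = 3) : shiftSum s ∈ shiftSpan t p := by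
  simpa using mul_shiftSum_mem hp ht hs (IsFrac.one s.length t)

lemma shiftSpan_mono {p p' : ℕ} (h : p ≤ p') : shiftSpan t p ≤ shiftSpan t p' :=
  Submodule.span_mono fun _ ⟨s, g, h1, h2⟩ => ⟨s, g, h1.trans h, h2⟩

lemma sum_telescope_mul (G D : ℕ → ℝ) (N : ℕ) :
    ∑ k ∈ Finset.range N, (G (k + 1 + 1) - G (k + 1)) * D (k + 1) =
      G (N + 1) * D N - G 1 * D 0 -
        ∑ k ∈ Finset.range N, G (k + 1) * (D (k + 1) - D k) := by
  induction N with
  | zero => simp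
  | succ N ih =>
    rw [Finset.sum_range_succ, Finset.sum_range_succ, ih]
    ring

lemma IsFrac.exists_sum_mul_shiftSum_eq {s : List ℕ} {f : ℕ → ℝ} (hf : IsFrac 2 s.length t f) :
    s.length + 1 ≤ t ∧ ∃ (α β : ℚ) (G : ℕ → ℝ), IsFrac 0 s.length (t - 1) G ∧
      (fun N => ∑ k ∈ Finset.range N, f (k + 1) * shiftSum s (k + 1)) =
        α • shiftSum (2 :: s) + β • shiftSum (3 :: s) + fun N => G (N + 1) * shiftSum s N -
          G 1 * shiftSum s 0 - ∑ k ∈ Finset.range N,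
            G (k + 1) * (shiftSum s (k + 1) - shiftSum s k) := by
  obtain ⟨m, rfl⟩ : ∃ m, t = s.length + m + 1 := by
    obtain ⟨P, hP, -⟩ := hf
    exact ⟨t - s.length - 1, by omega⟩
  obtain ⟨α, β, G, hG, h⟩ := hf.exists_telescope
  refine ⟨by omega, α, β, G, hG, ?_⟩
  ext N
  simp only [Pi.add_apply, Pi.smul_apply, ← sum_telescope_mul, shiftSum, Rat.smul_def,
    Finset.mul_sum, ← Finset.sum_add_distrib]
  refine Finset.sum_congr rfl fun k _ => ?_
  rw [h _ k.succ_pos]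
  ring

lemma sum_isFrac_mul_shiftSum_mem {s : List ℕ} (hs : ∀ a ∈ s, a = 2 ∨ a = 3) {f : ℕ → ℝ}
    (hf : IsFrac 2 s.length t f) :
    (fun N => ∑ k ∈ Finset.range N, f (k + 1) * shiftSum s (k + 1)) ∈
      shiftSpan t (s.length + 1) := by
  induction s generalizing f with
  | nil =>
    obtain ⟨ht, α, β, G, hG, h⟩ := hf.exists_sum_mul_shiftSum_eq
    obtain ⟨q, hq⟩ := hG.exists_rat one_pos
    rw [h]
    refine add_mem (add_mem (Submodule.smul_mem _ _ (shiftSum_mem le_rfl ht (by simp)))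
      (Submodule.smul_mem _ _ (shiftSum_mem le_rfl ht (by simp)))) ?_
    have h1 := mul_shiftSum_mem (t := t) (p := 1) (s := []) (by simp) (by simp) (by simp)
      (hG.shift.mono (a' := 0) (b' := t) (by simp) (by omega) (by simp))
    have h2 := Submodule.smul_mem _ q
      (shiftSum_mem (t := t) (p := 1) (s := []) (by simp) (by simp) (by simp))
    refine Set.mem_of_eq_of_mem (funext fun N => ?_) (sub_mem h1 h2)
    simp [shiftSum, hq, Rat.smul_def]
  | cons a L ih =>
    obtain ⟨ht, α, β, G, hG, h⟩ := hf.exists_sum_mul_shiftSum_eq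
    simp only [List.length_cons] at ht hG hf
    have hL : ∀ a ∈ L, a = 2 ∨ a = 3 := fun b hb => hs b (List.mem_cons_of_mem _ hb)
    rw [h]
    refine add_mem (add_mem
      (Submodule.smul_mem _ _ (shiftSum_mem le_rfl (by simpa using ht) (by simpa using hs)))
      (Submodule.smul_mem _ _ (shiftSum_mem le_rfl (by simpa using ht) (by simpa using hs)))) ?_
    have h1 := mul_shiftSum_mem (t := t) (p := L.length + 1 + 1) (s := a :: L) (by simp)
      (by simp; omega) hs
      (hG.shift.mono (a' := L.length + 1) (b' := t) (by omega) (by omega) (by omega))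
    have h2 := shiftSpan_mono (by omega : L.length + 1 ≤ L.length + 1 + 1) (ih hL
      (((IsFrac.inv_pow (hs a List.mem_cons_self) L.length).mul hG (by omega) (by omega)).mono
        le_rfl (by omega : t - 1 ≤ t) (by omega)))
    refine Set.mem_of_eq_of_mem (funext fun N => ?_) (sub_mem h1 h2)
    simp only [shiftSum_cons_zero, shiftSum_cons_succ, Pi.sub_apply, mul_zero, sub_zero,
      add_sub_cancel_left]
    congr 1
    exact Finset.sum_congr rfl fun k _ => by ring

lemma sum_isFrac_mul_mem {a b : ℕ} {R h : ℕ → ℝ} (hR : IsFrac 2 a b R) (hta : t ≤ a) (hab : a ≤ b)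
    (hh : h ∈ shiftSpan t p) :
    (fun N => ∑ k ∈ Finset.range N, R (k + 1) * h (k + 1)) ∈ shiftSpan b (p + 1) := by
  induction hh using Submodule.span_induction with
  | mem h hh =>
    obtain ⟨s, g, hp, ht, hs, hg, rfl⟩ := hh
    have := shiftSpan_mono (by omega : s.length + 1 ≤ p + 1) (sum_isFrac_mul_shiftSum_mem hs
      ((hg.mono le_rfl hta ht).mul hR (ht.trans hta) hab))
    refine Set.mem_of_eq_of_mem (funext fun N => Finset.sum_congr rfl fun k _ => ?_) this
    ring
  | zero => exact Set.mem_of_eq_of_mem (funext fun N => by simp) (zero_mem _)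
  | add h h' _ _ ih ih' =>
    refine Set.mem_of_eq_of_mem (funext fun N => ?_) (add_mem ih ih')
    simp [mul_add, Finset.sum_add_distrib]
  | smul q h _ ih =>
    refine Set.mem_of_eq_of_mem (funext fun N => ?_) (Submodule.smul_mem _ q ih)
    simp [Rat.smul_def, Finset.mul_sum, mul_left_comm]

lemma truncSum_mem_shiftSpan {R : Fin p → ℕ → ℝ} {n r : ℕ → ℕ}
    (hnr : ∀ i, i + 1 < p → r (i + 1) + n (i + 1) + 1 ≤ r i)
    (hR : ∀ i : Fin p, IsFrac 2 (r i) (r i + n i + 1) (R i)) :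
    truncSum 0 p R ∈ shiftSpan (if p = 0 then 0 else r 0 + n 0 + 1) p := by
  induction p generalizing n r with
  | zero => exact shiftSum_mem (s := []) le_rfl le_rfl (by simp)
  | succ p ih =>
    have h := ih (R := Fin.tail R) (n := fun i => n (i + 1)) (r := fun i => r (i + 1))
      (fun i hi => hnr _ (by omega)) fun i => hR i.succ
    refine sum_isFrac_mul_mem (hR 0) ?_ (by simp; omega) h
    rcases Nat.eq_zero_or_pos p with rfl | hp
    · simp
    · simpa [hp.ne'] using hnr 0 (by omega)

/-- The rational span of the multiple zeta values with at most `p` arguments, all `2` or `3`. -/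
noncomputable def mzvSpan (p : ℕ) : Submodule ℚ ℝ :=
  Submodule.span ℚ (mzv '' {s | s.length ≤ p ∧ ∀ a ∈ s, a = 2 ∨ a = 3})

lemma exists_tendsto_of_mem_shiftSpan {h : ℕ → ℝ} (hh : h ∈ shiftSpan t p) :
    ∃ x ∈ mzvSpan p, Tendsto h atTop (𝓝 x) := by
  induction hh using Submodule.span_induction with
  | mem h hh =>
    obtain ⟨s, g, hp, -, hs, hg, rfl⟩ := hh
    obtain ⟨q, hq⟩ := hg.exists_tendsto
    exact ⟨q • mzv s, Submodule.smul_mem _ _ (Submodule.subset_span ⟨s, ⟨hp, hs⟩, rfl⟩),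
      by simpa [Rat.smul_def] using hq.mul (tendsto_shiftSum hs)⟩
  | zero => exact ⟨0, zero_mem _, tendsto_const_nhds⟩
  | add h h' _ _ ih ih' =>
    obtain ⟨x, hx, hxt⟩ := ih
    obtain ⟨y, hy, hyt⟩ := ih'
    exact ⟨x + y, add_mem hx hy, hxt.add hyt⟩
  | smul q h _ ih =>
    obtain ⟨x, hx, hxt⟩ := ih
    exact ⟨q • x, Submodule.smul_mem _ _ hx, hxt.const_smul q⟩

end shiftSpan

lemma ascPochhammer_eval_eq_prod (m : ℕ) (x : ℝ) :
    (ascPochhammer ℝ m).eval x = ∏ j ∈ Finset.range m, (x + j) := by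
  induction m with
  | zero => simp
  | succ m ih => rw [ascPochhammer_succ_eval, ih, Finset.prod_range_succ]

lemma isFrac_pow_div_ascPochhammer {d n : ℕ} (r : ℕ) (hd : d ≤ 3 * n + 1) :
    IsFrac 2 r (r + n + 1)
      (fun k => (k : ℝ) ^ d / ((ascPochhammer ℝ (n + 1)).eval ((k : ℝ) + r)) ^ 3) := by
  refine ⟨X ^ d, by rw [natDegree_X_pow]; omega, fun k _ => ?_⟩
  beta_reduce
  rw [ascPochhammer_eval_eq_prod, Finset.prod_pow, Finset.prod_Ico_eq_prod_range]
  simp [add_assoc]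

lemma summable_and_tsum_mem_mzvSpan {p : ℕ} {n r : ℕ → ℕ}
    (hnr : ∀ i, i + 1 < p → r (i + 1) + n (i + 1) + 1 ≤ r i) {R : Fin p → ℕ → ℝ}
    (hR : ∀ i : Fin p, IsFrac 2 (r i) (r i + n i + 1) (R i)) :
    Summable (fun k : {k : Fin p → ℕ // Antitone k ∧ ∀ i, 1 ≤ k i} => ∏ i, R i (k.1 i)) ∧
      ∑' k : {k : Fin p → ℕ // Antitone k ∧ ∀ i, 1 ≤ k i}, ∏ i, R i (k.1 i) ∈ mzvSpan p := by
  choose B hB using fun i => (hR i).exists_bound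
  obtain ⟨hs, ht⟩ := summable_and_tendsto_truncSum (e := 0) hB
    (Q := fun k => Antitone k ∧ ∀ i, 1 ≤ k i) fun x =>
      and_congr_left' (by simpa using antitone_iff_forall_lt)
  obtain ⟨x, hx, hxt⟩ := exists_tendsto_of_mem_shiftSpan (truncSum_mem_shiftSpan hnr hR)
  exact ⟨hs, tendsto_nhds_unique ht hxt ▸ hx⟩

lemma exists_finset_of_mem_mzvSpan {p : ℕ} {x : ℝ} (hx : x ∈ mzvSpan p) :
    ∃ (T : Finset (List ℕ)) (c : List ℕ → ℚ),
      (∀ s ∈ T, s.length ≤ p ∧ ∀ a ∈ s, a = 2 ∨ a = 3) ∧ x = ∑ s ∈ T, (c s : ℝ) * mzv s := by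
  obtain ⟨l, hl, rfl⟩ := (Finsupp.mem_span_image_iff_linearCombination ℚ).1 hx
  refine ⟨l.support, l, fun s hs => (Finsupp.mem_supported ℚ l).1 hl hs, ?_⟩
  simp [Finsupp.linearCombination_apply, Finsupp.sum, Rat.smul_def]

theorem statement3 (p : ℕ) (hp : 0 < p) (n r : ℕ → ℕ)
    (h11 : ∀ i : ℕ, i + 1 < p → r (i + 1) + n (i + 1) + 1 ≤ r i)
    (P : MvPolynomial (Fin p) ℚ)
    (hdeg : ∀ i : Fin p, P.degreeOf i ≤ 3 * n i.1 + 1) :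
    Summable (fun k : {k : Fin p → ℕ // Antitone k ∧ ∀ i, 1 ≤ k i} =>
        ((MvPolynomial.eval (fun i => (k.1 i : ℚ)) P : ℚ) : ℝ) /
          ∏ i : Fin p,
            ((ascPochhammer ℝ (n i.1 + 1)).eval ((k.1 i : ℝ) + (r i.1 : ℝ))) ^ 3) ∧
    ∃ (T : Finset (List ℕ)) (c : List ℕ → ℚ),
      (∀ s ∈ T, s.length ≤ p ∧ ∀ a ∈ s, a = 2 ∨ a = 3) ∧
      (∑' k : {k : Fin p → ℕ // Antitone k ∧ ∀ i, 1 ≤ k i},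
          ((MvPolynomial.eval (fun i => (k.1 i : ℚ)) P : ℚ) : ℝ) /
            ∏ i : Fin p,
              ((ascPochhammer ℝ (n i.1 + 1)).eval ((k.1 i : ℝ) + (r i.1 : ℝ))) ^ 3)
        = ∑ s ∈ T, (c s : ℝ) * mzv s := by
  have hterm : ∀ k : {k : Fin p → ℕ // Antitone k ∧ ∀ i, 1 ≤ k i},
      ((MvPolynomial.eval (fun i => (k.1 i : ℚ)) P : ℚ) : ℝ) /
        ∏ i : Fin p,
          ((ascPochhammer ℝ (n i.1 + 1)).eval ((k.1 i : ℝ) + (r i.1 : ℝ))) ^ 3 =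
      ∑ d ∈ P.support, ((P.coeff d : ℚ) : ℝ) * ∏ i : Fin p, ((k.1 i : ℝ) ^ d i /
        ((ascPochhammer ℝ (n i.1 + 1)).eval ((k.1 i : ℝ) + (r i.1 : ℝ))) ^ 3) := by
    intro k
    rw [MvPolynomial.eval_eq', Rat.cast_sum, Finset.sum_div]
    refine Finset.sum_congr rfl fun d _ => ?_
    rw [Finset.prod_div_distrib, ← mul_div_assoc]
    push_cast
    rfl
  have hmon : ∀ d ∈ P.support, _ := fun d hd => summable_and_tsum_mem_mzvSpan h11
    (R := fun i k => (k : ℝ) ^ d i /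
      ((ascPochhammer ℝ (n i.1 + 1)).eval ((k : ℝ) + (r i.1 : ℝ))) ^ 3)
    fun i => isFrac_pow_div_ascPochhammer _
      ((MvPolynomial.monomial_le_degreeOf i hd).trans (hdeg i))
  simp only [hterm]
  refine ⟨summable_sum fun d hd => (hmon d hd).1.mul_left _, exists_finset_of_mem_mzvSpan ?_⟩
  rw [Summable.tsum_finsetSum fun d hd => (hmon d hd).1.mul_left _]
  refine Submodule.sum_mem _ fun d hd => ?_
  rw [tsum_mul_left, ← Rat.smul_def]
  exact Submodule.smul_mem _ _ (hmon d hd).2
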